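/- arXiv:1912.10378 — 5 statements merged into one kernel-verified Lean document; each statement's English description precedes it below -/
import Mathlib

section
/- Let f : (0,∞) → (0,∞) be an operator monotone function with f(1) = 1 (i.e. f ∈ OM_+^1). If there exists t₀ ∈ (0,∞) with t₀ ≠ 1 and f(t₀) = 1, then f(t) = 1 for all t ∈ (0,∞). -/
open Matrix Filter Set Topology
open scoped ComplexOrder

noncomputable def matFun {n : ℕ} (f : ℝ → ℝ) (A : Matrix (Fin n) (Fin n) ℂ) :
    Matrix (Fin n) (Fin n) ℂ := cfc f A

def loewnerLE {n : ℕ} (A B : Matrix (Fin n) (Fin n) ℂ) : Prop := (B - A).PosSemidef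

def OpMonotone (f : ℝ → ℝ) : Prop :=
  ∀ (n : ℕ) (A B : Matrix (Fin n) (Fin n) ℂ), A.PosDef → B.PosDef →
    loewnerLE A B → loewnerLE (matFun f A) (matFun f B)

def OMone (f : ℝ → ℝ) : Prop :=
  (∀ t : ℝ, 0 < t → 0 < f t) ∧ f 1 = 1 ∧ OpMonotone f

noncomputable def kuboMean {n : ℕ} (Φ : ℝ → ℝ) (A B : Matrix (Fin n) (Fin n) ℂ) :
    Matrix (Fin n) (Fin n) ℂ :=
  matFun Real.sqrt A *
    matFun Φ (matFun (fun x => (Real.sqrt x)⁻¹) A * B * matFun (fun x => (Real.sqrt x)⁻¹) A) *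
    matFun Real.sqrt A

def Subpreserves (Φ f : ℝ → ℝ) : Prop :=
  ∀ (n : ℕ) (A B : Matrix (Fin n) (Fin n) ℂ), A.PosDef → B.PosDef →
    loewnerLE (matFun f (kuboMean Φ A B)) (kuboMean Φ (matFun f A) (matFun f B))

def PreservesMean (Φ f : ℝ → ℝ) : Prop :=
  ∀ (n : ℕ) (A B : Matrix (Fin n) (Fin n) ℂ), A.PosDef → B.PosDef →
    matFun f (kuboMean Φ A B) = kuboMean Φ (matFun f A) (matFun f B)

def OMTrivial (f : ℝ → ℝ) : Prop :=
  (∀ t : ℝ, 0 < t → f t = 1) ∨ (∀ t : ℝ, 0 < t → f t = t)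

noncomputable def adjFun (f : ℝ → ℝ) : ℝ → ℝ := fun t => (f t⁻¹)⁻¹

noncomputable def transFun (f : ℝ → ℝ) : ℝ → ℝ := fun t => t * f t⁻¹


/-- The symmetric matrix with rows `(p, y)` and `(y, q)`, with real entries seen in `ℂ`. -/
def symmTwo (p q y : ℝ) : Matrix (Fin 2) (Fin 2) ℂ := !![(p : ℂ), (y : ℂ); (y : ℂ), (q : ℂ)]

theorem symmTwo_isHermitian (p q y : ℝ) : (symmTwo p q y).IsHermitian := by
  ext i j
  fin_cases i <;> fin_cases j <;> simp [symmTwo]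

theorem symmTwo_sub (p q y p' q' y' : ℝ) :
    symmTwo p q y - symmTwo p' q' y' = symmTwo (p - p') (q - q') (y - y') := by
  ext i j
  fin_cases i <;> fin_cases j <;> simp [symmTwo]

theorem symmTwo_add (p q y p' q' y' : ℝ) :
    symmTwo p q y + symmTwo p' q' y' = symmTwo (p + p') (q + q') (y + y') := by
  ext i j
  fin_cases i <;> fin_cases j <;> simp [symmTwo]

theorem symmTwo_zero_eq_diagonal (p q : ℝ) :
    symmTwo p q 0 = Matrix.diagonal ![(p : ℂ), (q : ℂ)] := by
  ext i j
  fin_cases i <;> fin_cases j <;> simp [symmTwo]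

theorem symmTwo_zero_posDef {p q : ℝ} (hp : 0 < p) (hq : 0 < q) : (symmTwo p q 0).PosDef := by
  rw [symmTwo_zero_eq_diagonal]
  refine Matrix.PosDef.diagonal fun i => ?_
  fin_cases i <;> simpa

theorem symmTwo_posSemidef_of_det_eq_zero {p q y : ℝ} (hp : 0 < p) (h : p * q = y ^ 2) :
    (symmTwo p q y).PosSemidef := by
  have key : symmTwo p q y =
      p⁻¹ • Matrix.vecMulVec ![(p : ℂ), (y : ℂ)] (star ![(p : ℂ), (y : ℂ)]) := by
    have hp' : (p : ℂ) ≠ 0 := by exact_mod_cast hp.ne'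
    have h' : (p : ℂ) * q = y ^ 2 := by exact_mod_cast h
    ext i j
    rw [Matrix.smul_apply, Matrix.vecMulVec_apply, Complex.real_smul]
    fin_cases i <;> fin_cases j <;> simp [symmTwo, hp', mul_comm (y : ℂ)]
    field_simp
    linear_combination h'
  rw [key]
  exact (Matrix.posSemidef_vecMulVec_self_star _).smul (inv_nonneg.2 hp.le)

theorem symmTwo_quadratic_nonneg {p q y : ℝ} (h : (symmTwo p q y).PosSemidef) (k l : ℝ) :
    0 ≤ p * k ^ 2 + 2 * y * (k * l) + q * l ^ 2 := by
  have h1 := h.dotProduct_mulVec_nonneg ![(k : ℂ), (l : ℂ)]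
  have h2 : star ![(k : ℂ), (l : ℂ)] ⬝ᵥ (symmTwo p q y *ᵥ ![(k : ℂ), (l : ℂ)]) =
      ((p * k ^ 2 + 2 * y * (k * l) + q * l ^ 2 : ℝ) : ℂ) := by
    simp [symmTwo, Matrix.mulVec, dotProduct, Fin.sum_univ_two]
    ring
  rw [h2] at h1
  exact_mod_cast h1

theorem symmTwo_spectrum_subset {p q y u w : ℝ} (htr : p + q = u + w)
    (hdet : p * q - y ^ 2 = u * w) : spectrum ℝ (symmTwo p q y) ⊆ {u, w} := by
  intro x hx
  rw [spectrum.mem_iff, Matrix.isUnit_iff_isUnit_det, isUnit_iff_ne_zero, not_not] at hx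
  have hdetx : (algebraMap ℝ (Matrix (Fin 2) (Fin 2) ℂ) x - symmTwo p q y).det =
      (((x - p) * (x - q) - y ^ 2 : ℝ) : ℂ) := by
    simp [symmTwo, Matrix.det_fin_two, Matrix.algebraMap_matrix_apply]
    ring
  rw [hdetx] at hx
  have h0 : (x - p) * (x - q) - y ^ 2 = 0 := by exact_mod_cast hx
  have h1 : (x - u) * (x - w) = 0 := by linear_combination h0 + x * htr - hdet
  rcases mul_eq_zero.1 h1 with h | h
  · left; linarith
  · right; exact sub_eq_zero.1 h

theorem matFun_symmTwo (f : ℝ → ℝ) {p q y u w : ℝ} (huw : u ≠ w) (htr : p + q = u + w)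
    (hdet : p * q - y ^ 2 = u * w) :
    matFun f (symmTwo p q y) =
      symmTwo (f u + (f w - f u) / (w - u) * (p - u)) (f u + (f w - f u) / (w - u) * (q - u))
        ((f w - f u) / (w - u) * y) := by
  set κ := (f w - f u) / (w - u)
  have hsa : IsSelfAdjoint (symmTwo p q y) := symmTwo_isHermitian p q y
  have hcongr : (spectrum ℝ (symmTwo p q y)).EqOn f fun x => (f u - κ * u) + κ * x := by
    intro x hx
    have hwu : w - u ≠ 0 := sub_ne_zero.2 huw.symm
    rcases symmTwo_spectrum_subset htr hdet hx with rfl | rfl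
    · simp
    · have : κ * (x - u) = f x - f u := div_mul_cancel₀ _ hwu
      simp only
      linarith
  rw [matFun, cfc_congr hcongr, cfc_const_add .., cfc_const_mul_id ..]
  obtain ⟨α, hα⟩ : ∃ α, f u - κ * u = α := ⟨_, rfl⟩
  have hshift (x : ℝ) : f u + κ * (x - u) = α + κ * x := by linear_combination hα
  rw [hα, hshift, hshift]
  ext i j
  fin_cases i <;> fin_cases j <;> simp [symmTwo, Matrix.algebraMap_matrix_apply]

theorem OpMonotone.monotone {f : ℝ → ℝ} (hf : OpMonotone f) {a b : ℝ} (ha : 0 < a) (hab : a ≤ b) :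
    f a ≤ f b := by
  rcases hab.eq_or_lt with rfl | hlt
  · exact le_rfl
  have hb := ha.trans hlt
  have hpsd : loewnerLE (symmTwo a b 0) (symmTwo b (b + 1) 0) := by
    rw [loewnerLE, symmTwo_sub, sub_zero, symmTwo_zero_eq_diagonal]
    refine Matrix.PosSemidef.diagonal fun i => ?_
    fin_cases i
    · simpa using hlt.le
    · simp
  have h := hf 2 _ _ (symmTwo_zero_posDef ha hb)
    (symmTwo_zero_posDef hb (by linarith : 0 < b + 1)) hpsd
  rw [matFun_symmTwo f hlt.ne rfl (by ring), matFun_symmTwo f (lt_add_one b).ne rfl (by ring),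
    loewnerLE, symmTwo_sub] at h
  have := symmTwo_quadratic_nonneg h 1 0
  simp only [sub_self, mul_zero, add_zero] at this
  linarith

theorem OpMonotone.le_of_flat_left {f : ℝ → ℝ} (hf : OpMonotone f) {a b s : ℝ} (ha : 0 < a)
    (hab : a < b) (hbs : b < s) (hflat : f a = f b) : f s ≤ f b := by
  have hδ : 0 < b - a := sub_pos.2 hab
  have hσ : 0 < s - b := sub_pos.2 hbs
  obtain ⟨y, hy⟩ : ∃ y : ℝ, y ^ 2 = 2 * (s - b) * (b - a) :=
    ⟨_, Real.sq_sqrt (by positivity)⟩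
  have hA := symmTwo_zero_posDef ha (by linarith : 0 < s)
  have hD : (symmTwo (2 * (b - a)) (s - b) y).PosSemidef :=
    symmTwo_posSemidef_of_det_eq_zero (by positivity) (by linarith)
  have hsum : symmTwo (b + (b - a)) (s + (s - b)) y =
      symmTwo a s 0 + symmTwo (2 * (b - a)) (s - b) y := by
    rw [symmTwo_add]; congr 1 <;> ring
  have h := hf 2 (symmTwo a s 0) (symmTwo (b + (b - a)) (s + (s - b)) y) hA
    (hsum ▸ hA.add_posSemidef hD) (by rw [hsum, loewnerLE, add_sub_cancel_left]; exact hD)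
  rw [matFun_symmTwo f (u := a) (w := s) (by linarith) rfl (by ring),
    matFun_symmTwo f (u := b) (w := b + (b - a) + 2 * (s - b)) (by linarith) (by ring)
      (by linear_combination -hy), loewnerLE, symmTwo_sub] at h
  have hq := symmTwo_quadratic_nonneg h y (-(b - a))
  have hs : (f s - f a) / (s - a) * (s - a) = f s - f a := div_mul_cancel₀ _ (by linarith)
  generalize (f s - f a) / (s - a) = κ at hq hs
  generalize (f (b + (b - a) + 2 * (s - b)) - f b) / _ = μ at hq
  have hval : 0 ≤ (f b - f s) * (b - a) ^ 2 := by
    refine hq.trans_eq ?_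
    rw [hflat] at hs ⊢
    linear_combination -(b - a) ^ 2 * hs - μ * (b - a) * hy
  have := nonneg_of_mul_nonneg_left hval (by positivity)
  linarith

theorem OpMonotone.le_of_flat_right {f : ℝ → ℝ} (hf : OpMonotone f) {a b s : ℝ} (hs : 0 < s)
    (hsa : s < a) (hab : a < b) (hflat : f a = f b) : f a ≤ f s := by
  have hδ : 0 < b - a := sub_pos.2 hab
  have hσ : 0 < a - s := sub_pos.2 hsa
  have hb : 0 < b := by linarith
  obtain ⟨t, ht, hts⟩ : ∃ t : ℝ, 0 < t ∧ t * (b - s) < s := by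
    refine ⟨s / b, by positivity, ?_⟩
    rw [div_mul_eq_mul_div, div_lt_iff₀ hb]
    nlinarith
  obtain ⟨y, hy⟩ : ∃ y : ℝ, y ^ 2 = t * (1 + t) * ((b - a) * (a - s)) :=
    ⟨_, Real.sq_sqrt (by positivity)⟩
  have hpos : 0 < s - t * (b - s) := by linarith
  have hA : (symmTwo (a - t * (b - a)) (a - (1 + t) * (a - s)) y).PosDef := by
    have hsum : symmTwo (a - t * (b - a)) (a - (1 + t) * (a - s)) y =
        symmTwo (s - t * (b - s)) (s - t * (b - s)) 0 +
          symmTwo ((1 + t) * (a - s)) (t * (b - a)) y := by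
      rw [symmTwo_add]; congr 1 <;> ring
    rw [hsum]
    exact (symmTwo_zero_posDef hpos hpos).add_posSemidef
      (symmTwo_posSemidef_of_det_eq_zero (by positivity) (by linarith))
  have hle : loewnerLE (symmTwo (a - t * (b - a)) (a - (1 + t) * (a - s)) y)
      (symmTwo b s 0) := by
    rw [loewnerLE, symmTwo_sub]
    refine symmTwo_posSemidef_of_det_eq_zero ?_ (by linear_combination -hy)
    nlinarith [mul_pos ht hδ]
  have h := hf 2 _ _ hA (symmTwo_zero_posDef hb hs) hle
  have hne : a ≠ s - t * (b - s) := by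
    have : 0 < t * (b - s) := mul_pos ht (by linarith)
    linarith
  rw [matFun_symmTwo f (u := b) (w := s) (by linarith) rfl (by ring),
    matFun_symmTwo f (u := a) (w := s - t * (b - s)) hne (by ring)
      (by linear_combination -hy), loewnerLE, symmTwo_sub] at h
  have hq := symmTwo_quadratic_nonneg h y (t * (b - a))
  have hsb : (f s - f b) / (s - b) * (s - b) = f s - f b := div_mul_cancel₀ _ (by linarith)
  generalize (f s - f b) / (s - b) = κ at hq hsb
  generalize (f (s - t * (b - s)) - f a) / _ = μ at hq
  have hval : 0 ≤ (f s - f a) * (t * (b - a)) ^ 2 := by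
    refine hq.trans_eq ?_
    rw [hflat]
    linear_combination (t * (b - a)) ^ 2 * hsb - μ * t * (b - a) * hy
  have := nonneg_of_mul_nonneg_left hval (by positivity)
  linarith

theorem OpMonotone.eq_of_flat {f : ℝ → ℝ} (hf : OpMonotone f) {a b : ℝ} (ha : 0 < a)
    (hab : a < b) (hflat : f a = f b) {t : ℝ} (ht : 0 < t) : f t = f a := by
  rcases lt_or_ge t a with hta | hta
  · exact (hf.monotone ht hta.le).antisymm (hf.le_of_flat_right ht hta hab hflat)
  refine le_antisymm ?_ (hf.monotone ha hta)
  rcases le_or_gt t b with htb | htb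
  · exact (hf.monotone ht htb).trans_eq hflat.symm
  · exact (hf.le_of_flat_left ha hab htb hflat).trans_eq hflat.symm

theorem stmt_0 (f : ℝ → ℝ) (hf : OMone f)
    (h : ∃ t₀ : ℝ, 0 < t₀ ∧ t₀ ≠ 1 ∧ f t₀ = 1) :
    ∀ t : ℝ, 0 < t → f t = 1 := by
  obtain ⟨-, h1, hmono⟩ := hf
  obtain ⟨t₀, ht₀, hne, hft₀⟩ := h
  intro t ht
  rcases hne.lt_or_gt with hlt | hlt
  · exact (hmono.eq_of_flat ht₀ hlt (hft₀.trans h1.symm) ht).trans hft₀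
  · exact (hmono.eq_of_flat one_pos hlt (h1.trans hft₀.symm) ht).trans h1
end

section
/- Let f and Φ be non-trivial functions in OM_+^1 such that f is σ_Φ-subpreserving and Φ*(0) = 0. Then f*(0) = 0. -/
open Matrix Filter Set Topology
open scoped ComplexOrder

def symMat (p q r : ℝ) : Matrix (Fin 2) (Fin 2) ℂ := !![(p : ℂ), q; q, r]

theorem isHermitian_symMat (p q r : ℝ) : (symMat p q r).IsHermitian := by
  ext i j
  fin_cases i <;> fin_cases j <;> simp [symMat]

theorem posSemidef_symMat {p q r : ℝ} (hp : 0 ≤ p) (hr : 0 ≤ r) (h : q ^ 2 ≤ p * r) :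
    (symMat p q r).PosSemidef := by
  have key : ∀ u v : ℝ, 0 ≤ p * u ^ 2 + 2 * q * u * v + r * v ^ 2 := by
    intro u v
    rcases hp.eq_or_lt with rfl | hp
    · have hq : q = 0 := by nlinarith [sq_nonneg q]
      subst hq
      nlinarith [mul_nonneg hr (sq_nonneg v)]
    · have : 0 ≤ p * (p * u ^ 2 + 2 * q * u * v + r * v ^ 2) := by
        nlinarith [sq_nonneg (p * u + q * v), mul_nonneg (sub_nonneg.2 h) (sq_nonneg v)]
      exact nonneg_of_mul_nonneg_right this hp
  refine Matrix.PosSemidef.of_dotProduct_mulVec_nonneg (isHermitian_symMat p q r) fun z => ?_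
  have e : star z ⬝ᵥ (symMat p q r *ᵥ z) =
      ((p * (z 0).re ^ 2 + 2 * q * (z 0).re * (z 1).re + r * (z 1).re ^ 2 +
        (p * (z 0).im ^ 2 + 2 * q * (z 0).im * (z 1).im + r * (z 1).im ^ 2) : ℝ) : ℂ) := by
    apply Complex.ext <;>
    · simp [symMat, dotProduct, Fin.sum_univ_two, Matrix.mulVec, -Complex.ofReal_pow]
      ring
  rw [e]
  exact_mod_cast add_nonneg (key _ _) (key _ _)

theorem posSemidef_symMat_iff {p q r : ℝ} :
    (symMat p q r).PosSemidef ↔ 0 ≤ p ∧ 0 ≤ r ∧ q ^ 2 ≤ p * r := by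
  refine ⟨fun h => ⟨?_, ?_, ?_⟩, fun ⟨hp, hr, h⟩ => posSemidef_symMat hp hr h⟩
  · simpa [symMat] using h.diag_nonneg (i := 0)
  · simpa [symMat] using h.diag_nonneg (i := 1)
  · have := h.det_nonneg
    rw [symMat, Matrix.det_fin_two_of] at this
    have h' : (0 : ℝ) ≤ p * r - q * q := by exact_mod_cast this
    nlinarith

/-- The symmetric matrix with eigenvalue `a` on `(x, y)` and `b` on `(-y, x)`,
when `x ^ 2 + y ^ 2 = 1`. -/
def rotMat (a b x y : ℝ) : Matrix (Fin 2) (Fin 2) ℂ :=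
  symMat (a * x ^ 2 + b * y ^ 2) ((a - b) * (x * y)) (a * y ^ 2 + b * x ^ 2)

theorem posDef_rotMat {a b x y : ℝ} (ha : 0 < a) (hb : 0 < b) (h : x ^ 2 + y ^ 2 = 1) :
    (rotMat a b x y).PosDef := by
  have e : (a * x ^ 2 + b * y ^ 2) * (a * y ^ 2 + b * x ^ 2) - ((a - b) * (x * y)) ^ 2 = a * b := by
    linear_combination (a * b * (x ^ 2 + y ^ 2 + 1)) * h
  have hs : (rotMat a b x y).PosSemidef :=
    posSemidef_symMat (by positivity) (by positivity) (by nlinarith [mul_pos ha hb])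
  rw [hs.posDef_iff_isUnit, Matrix.isUnit_iff_isUnit_det, rotMat, symMat, Matrix.det_fin_two_of,
    isUnit_iff_ne_zero]
  have : (a * x ^ 2 + b * y ^ 2) * (a * y ^ 2 + b * x ^ 2)
      - ((a - b) * (x * y)) * ((a - b) * (x * y)) ≠ 0 := by
    rw [← sq, e]; positivity
  exact_mod_cast this

theorem matFun_rotMat (f : ℝ → ℝ) {a b x y : ℝ} (h : x ^ 2 + y ^ 2 = 1) :
    matFun f (rotMat a b x y) = rotMat (f a) (f b) x y := by
  set R := rotMat a b x y with hR
  have hsa : IsSelfAdjoint R := isHermitian_symMat _ _ _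
  have hspec : ∀ l ∈ spectrum ℝ R, l = a ∨ l = b := by
    intro l hl
    by_contra! hne
    have h0 : (l - a) * (l - b) ≠ 0 := mul_ne_zero (sub_ne_zero.2 hne.1) (sub_ne_zero.2 hne.2)
    refine hl ?_
    refine (Matrix.isUnit_iff_isUnit_det _).2 (isUnit_iff_ne_zero.2 ?_)
    have e : (algebraMap ℝ (Matrix (Fin 2) (Fin 2) ℂ) l - R) =
        symMat (l - (a * x ^ 2 + b * y ^ 2)) (-((a - b) * (x * y)))
          (l - (a * y ^ 2 + b * x ^ 2)) := by
      ext i j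
      fin_cases i <;> fin_cases j <;>
        simp [hR, rotMat, symMat, Matrix.algebraMap_matrix_apply]
    rw [e, symMat, Matrix.det_fin_two_of]
    have e2 : (l - (a * x ^ 2 + b * y ^ 2)) * (l - (a * y ^ 2 + b * x ^ 2))
      - (-((a - b) * (x * y))) * (-((a - b) * (x * y))) = (l - a) * (l - b) := by
      linear_combination (a * b * (x ^ 2 + y ^ 2 + 1) - l * (a + b)) * h
    rw [← e2] at h0
    exact_mod_cast h0
  set m := (f b - f a) / (b - a)
  have hmab : m * (b - a) = f b - f a := by
    rcases eq_or_ne b a with rfl | hne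
    · simp
    · exact div_mul_cancel₀ _ (sub_ne_zero.2 hne)
  have h1 : matFun f R = cfc (fun t : ℝ => (f a - m * a) + m * t) R := by
    refine cfc_congr fun l hl => ?_
    rcases hspec l hl with rfl | rfl
    · simp
    · linarith
  rw [h1, cfc_const_add _ _ _, cfc_const_mul_id _ _ hsa]
  have e1 : (f a - m * a) + m * (a * x ^ 2 + b * y ^ 2) = f a * x ^ 2 + f b * y ^ 2 := by
    linear_combination y ^ 2 * hmab + (m * a - f a) * h
  have e2 : m * ((a - b) * (x * y)) = (f a - f b) * (x * y) := by
    linear_combination -(x * y) * hmab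
  have e3 : (f a - m * a) + m * (a * y ^ 2 + b * x ^ 2) = f a * y ^ 2 + f b * x ^ 2 := by
    linear_combination x ^ 2 * hmab + (m * a - f a) * h
  rw [rotMat, ← e1, ← e2, ← e3]
  generalize f a - m * a = k
  ext i j
  fin_cases i <;> fin_cases j <;>
    simp [hR, rotMat, symMat, Matrix.algebraMap_matrix_apply, mul_add]

/-- Operator monotonicity for a pair of `2 × 2` matrices, the larger one being diagonal,
expressed through entries and determinants. -/
theorem OpMonotone.rotMat_le {f : ℝ → ℝ} (hf : OpMonotone f) {a b c d x y : ℝ} (ha : 0 < a)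
    (hb : 0 < b) (hc : 0 < c) (hd : 0 < d) (h : x ^ 2 + y ^ 2 = 1)
    (h1 : 0 ≤ c - (a * x ^ 2 + b * y ^ 2)) (h2 : 0 ≤ d - (a * y ^ 2 + b * x ^ 2))
    (h3 : ((a - b) * (x * y)) ^ 2 ≤ (c - (a * x ^ 2 + b * y ^ 2)) * (d - (a * y ^ 2 + b * x ^ 2))) :
    0 ≤ f c - (f a * x ^ 2 + f b * y ^ 2) ∧ 0 ≤ f d - (f a * y ^ 2 + f b * x ^ 2) ∧
    ((f a - f b) * (x * y)) ^ 2 ≤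
      (f c - (f a * x ^ 2 + f b * y ^ 2)) * (f d - (f a * y ^ 2 + f b * x ^ 2)) := by
  have hsub : ∀ a b c d : ℝ, rotMat c d 1 0 - rotMat a b x y =
      symMat (c - (a * x ^ 2 + b * y ^ 2)) (-((a - b) * (x * y)))
        (d - (a * y ^ 2 + b * x ^ 2)) := by
    intro a b c d
    ext i j
    fin_cases i <;> fin_cases j <;> simp [rotMat, symMat]
  have h10 : (1 : ℝ) ^ 2 + 0 ^ 2 = 1 := by norm_num
  have := hf 2 (rotMat a b x y) (rotMat c d 1 0) (posDef_rotMat ha hb h) (posDef_rotMat hc hd h10)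
  rw [matFun_rotMat f h, matFun_rotMat f h10, loewnerLE, loewnerLE, hsub, hsub,
    posSemidef_symMat_iff, posSemidef_symMat_iff, neg_sq, neg_sq] at this
  exact this ⟨h1, h2, h3⟩

theorem OMone.monotoneOn {f : ℝ → ℝ} (hf : OMone f) {s t : ℝ} (hs : 0 < s) (hst : s ≤ t) :
    f s ≤ f t := by
  have := (hf.2.2.rotMat_le (x := 1) (y := 0) hs hs (hs.trans_le hst) hs (by norm_num)
    (by linarith) (by linarith) (by simp)).1
  linarith

theorem OMone.mul_apply_le_mul_apply {f : ℝ → ℝ} (hf : OMone f) {s t : ℝ} (hs : 0 < s) (hst : s ≤ t) :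
    s * f t ≤ t * f s := by
  have ht : 0 < t := hs.trans_le hst
  have hft := hf.1 t ht
  have hfs := hf.1 s hs
  by_contra! hlt
  have hx : (√(f s / f t)) ^ 2 = f s / f t := Real.sq_sqrt (by positivity)
  set x := √(f s / f t)
  clear_value x
  have hxt : t * x ^ 2 < s := by
    rw [hx, ← mul_div_assoc]
    exact (div_lt_iff₀ hft).2 hlt
  have hx1 : x ^ 2 < 1 := by
    by_contra! h1
    nlinarith
  have hy : (√(1 - x ^ 2)) ^ 2 = 1 - x ^ 2 := Real.sq_sqrt (by linarith)
  set y := √(1 - x ^ 2)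
  obtain ⟨e, rfl⟩ : ∃ e, s = t * x ^ 2 + 2 * e := ⟨(s - t * x ^ 2) / 2, by ring⟩
  have he : 0 < e := by linarith
  have het : e < t := by nlinarith [mul_nonneg ht.le (sq_nonneg x)]
  have hx0 := sq_nonneg x
  have hp : e ≤ t * x ^ 2 + 2 * e - (t * x ^ 2 + e * y ^ 2) := by rw [hy]; nlinarith
  have hr : t ^ 2 / e ≤ t + e + t ^ 2 / e - (t * y ^ 2 + e * x ^ 2) := by rw [hy]; nlinarith
  have hte : 0 < t ^ 2 / e := by positivity
  have hq : ((t - e) * (x * y)) ^ 2 ≤ e * (t ^ 2 / e) := by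
    rw [mul_div_cancel₀ _ he.ne', mul_pow, mul_pow, hy]
    have h1 : (t - e) ^ 2 ≤ t ^ 2 := by nlinarith
    have h2 : x ^ 2 * (1 - x ^ 2) ≤ 1 := by nlinarith
    exact (mul_le_mul h1 h2 (mul_nonneg hx0 (by linarith)) (sq_nonneg t)).trans_eq (mul_one _)
  have key := (hf.2.2.rotMat_le (a := t) (b := e) (d := t + e + t ^ 2 / e) (x := x) (y := y)
    ht he hs (by positivity) (by rw [hy]; ring) (he.le.trans hp) (hte.le.trans hr)
    (hq.trans (mul_le_mul hp hr hte.le (he.le.trans hp)))).1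
  have hfe := mul_pos (hf.1 e he) (sub_pos.2 hx1)
  rw [← hy] at hfe
  have hfx : f t * x ^ 2 = f (t * x ^ 2 + 2 * e) := by
    rwa [mul_comm, ← eq_div_iff hft.ne']
  linarith

theorem OMone.eq_id {Φ : ℝ → ℝ} (hΦ : OMone Φ) {z : ℝ} (hz : 1 < z) (hΦz : Φ z = z) :
    ∀ t : ℝ, 0 < t → Φ t = t := by
  have hle : ∀ t, 1 ≤ t → Φ t ≤ t := by
    intro t ht
    have := hΦ.mul_apply_le_mul_apply one_pos ht
    rw [hΦ.2.1] at this
    linarith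
  have hmid : ∀ t, 1 ≤ t → t ≤ z → Φ t = t := by
    intro t ht htz
    have := hΦ.mul_apply_le_mul_apply (one_pos.trans_le ht) htz
    rw [hΦz] at this
    exact le_antisymm (hle t ht) (by nlinarith)
  have hge : ∀ t, 1 ≤ t → Φ t = t := by
    intro t ht
    rcases le_total t z with htz | htz
    · exact hmid t ht htz
    obtain ⟨h, rfl⟩ : ∃ h, z = 1 + 2 * h := ⟨(z - 1) / 2, by ring⟩
    obtain ⟨T, rfl⟩ : ∃ T, t = 1 + T := ⟨t - 1, by ring⟩
    have hh : 0 < h := by linarith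
    have hT : 2 * h ≤ T := by linarith
    have hTh : 0 < T - h := by linarith
    have hx : (√(T / (2 * (T - h)))) ^ 2 = T / (2 * (T - h)) :=
      Real.sq_sqrt (div_nonneg (by linarith) (by linarith))
    have hy : (√((T - 2 * h) / (2 * (T - h)))) ^ 2 = (T - 2 * h) / (2 * (T - h)) :=
      Real.sq_sqrt (div_nonneg (by linarith) (by linarith))
    set x := √(T / (2 * (T - h)))
    set y := √((T - 2 * h) / (2 * (T - h)))
    have hne : T - h ≠ 0 := hTh.ne'
    have e0 : x ^ 2 + y ^ 2 = 1 := by rw [hx, hy]; field_simp; ring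
    have e1 : 1 + T - ((1 + 2 * h) * x ^ 2 + 1 * y ^ 2) = T * (T - 2 * h) / (T - h) := by
      rw [hx, hy]; field_simp; ring
    have e2 : 1 + h - ((1 + 2 * h) * y ^ 2 + 1 * x ^ 2) = h ^ 2 / (T - h) := by
      rw [hx, hy]; field_simp; ring
    have e3 : (((1 + 2 * h) - 1) * (x * y)) ^ 2 =
        T * (T - 2 * h) / (T - h) * (h ^ 2 / (T - h)) := by
      rw [mul_pow, mul_pow, hx, hy]; field_simp; ring
    have key := (hΦ.2.2.rotMat_le (a := 1 + 2 * h) (b := 1) (c := 1 + T) (d := 1 + h)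
      (x := x) (y := y) (by linarith) one_pos (by linarith) (by linarith) e0
      (by rw [e1]; exact div_nonneg (mul_nonneg (by linarith) (by linarith)) hTh.le)
      (by rw [e2]; positivity) (by rw [e1, e2, e3])).2.2
    rw [hΦz, hΦ.2.1, hmid (1 + h) (by linarith) (by linarith), e2, e3] at key
    have := le_of_mul_le_mul_right key (by positivity)
    exact le_antisymm (hle _ ht) (by linarith)
  intro t ht
  rcases le_total 1 t with h1 | h1
  · exact hge t h1
  have hlow : t ≤ Φ t := by
    have := hΦ.mul_apply_le_mul_apply ht h1
    rw [hΦ.2.1] at this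
    linarith
  rcases h1.eq_or_lt with rfl | h1
  · exact hΦ.2.1
  refine le_antisymm ?_ hlow
  obtain ⟨u, rfl⟩ : ∃ u, t = 1 - u := ⟨1 - t, by ring⟩
  have hu : 0 < u := by linarith
  have hx : (√(u / (2 * (1 + u)))) ^ 2 = u / (2 * (1 + u)) := Real.sq_sqrt (by positivity)
  have hy : (√((2 + u) / (2 * (1 + u)))) ^ 2 = (2 + u) / (2 * (1 + u)) :=
    Real.sq_sqrt (by positivity)
  set x := √(u / (2 * (1 + u)))
  set y := √((2 + u) / (2 * (1 + u)))
  have e0 : x ^ 2 + y ^ 2 = 1 := by rw [hx, hy]; field_simp; ring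
  have e1 : 3 - ((1 - u) * x ^ 2 + 2 * y ^ 2) = (2 + u) / 2 := by
    rw [hx, hy]; field_simp; ring
  have e2 : 1 - ((1 - u) * y ^ 2 + 2 * x ^ 2) = u / 2 := by
    rw [hx, hy]; field_simp; ring
  have key := (hΦ.2.2.rotMat_le (a := 1 - u) (b := 2) (c := 3) (d := 1)
    (x := x) (y := y) ht two_pos three_pos one_pos e0
    (by rw [e1]; positivity) (by rw [e2]; positivity)
    (by rw [e1, e2, mul_pow, mul_pow, hx, hy]; field_simp; ring_nf; rfl)).2.2
  rw [hge 2 (by norm_num), hge 3 (by norm_num), hΦ.2.1, mul_pow, mul_pow, hx, hy] at key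
  field_simp at key
  nlinarith

theorem Subpreserves.scalar {Φ f : ℝ → ℝ} (h : Subpreserves Φ f) (hf : ∀ t, 0 < t → 0 < f t)
    {a b : ℝ} (ha : 0 < a) (hb : 0 < b) : f (a * Φ (b / a)) ≤ f a * Φ (f b / f a) := by
  have hk : ∀ a b : ℝ, 0 < a → kuboMean Φ (algebraMap ℝ (Matrix (Fin 1) (Fin 1) ℂ) a)
      (algebraMap ℝ _ b) = algebraMap ℝ _ (a * Φ (b / a)) := by
    intro a b ha
    have e : (√a)⁻¹ * b * (√a)⁻¹ = b / a := by
      rw [mul_right_comm, ← mul_inv, Real.mul_self_sqrt ha.le, div_eq_inv_mul]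
    have e' : √a * Φ (b / a) * √a = a * Φ (b / a) := by
      rw [mul_right_comm, Real.mul_self_sqrt ha.le]
    simp only [kuboMean, matFun, cfc_algebraMap, ← map_mul, e, e']
  have hpd : ∀ a : ℝ, 0 < a → (algebraMap ℝ (Matrix (Fin 1) (Fin 1) ℂ) a).PosDef := by
    intro a ha
    rw [Algebra.algebraMap_eq_smul_one]
    exact Matrix.PosDef.one.smul ha
  have := h 1 _ _ (hpd a ha) (hpd b hb)
  rw [hk a b ha] at this
  simp only [matFun, cfc_algebraMap] at this
  rw [hk _ _ (hf a ha), loewnerLE, ← map_sub] at this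
  have := this.diag_nonneg (i := 0)
  rw [Matrix.algebraMap_matrix_apply] at this
  simp only [if_true, Complex.coe_algebraMap] at this
  exact sub_nonneg.1 (Complex.zero_le_real.1 this)

theorem stmt_1 (f Φ : ℝ → ℝ) (hf : OMone f) (hΦ : OMone Φ)
    (hfnt : ¬ OMTrivial f) (hΦnt : ¬ OMTrivial Φ)
    (hsub : Subpreserves Φ f)
    (hΦstar0 : Filter.Tendsto (adjFun Φ) (nhdsWithin 0 (Set.Ioi 0)) (nhds 0)) :
    Filter.Tendsto (adjFun f) (nhdsWithin 0 (Set.Ioi 0)) (nhds 0) := by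
  obtain ⟨hfpos, hf1, -⟩ := id hf
  obtain ⟨hΦpos, hΦ1, -⟩ := id hΦ
  suffices hunb : ∀ M : ℝ, ∃ t, 0 < t ∧ M < f t by
    have hat : Tendsto f atTop atTop := by
      refine tendsto_atTop.2 fun M => ?_
      obtain ⟨t, ht, hM⟩ := hunb M
      filter_upwards [eventually_ge_atTop t] with s hs
      exact hM.le.trans (hf.monotoneOn ht hs)
    exact (hat.comp tendsto_inv_nhdsGT_zero).inv_tendsto_atTop
  by_contra! hbdd
  obtain ⟨M, hM⟩ := hbdd
  have hbd : BddAbove (f '' Ioi 0) := ⟨M, by rintro _ ⟨t, ht, rfl⟩; exact hM t ht⟩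
  set c := sSup (f '' Ioi 0)
  have hc : ∀ t, 0 < t → f t ≤ c := fun t ht => le_csSup hbd ⟨t, ht, rfl⟩
  obtain ⟨a, ha, hac⟩ : ∃ a, 0 < a ∧ f a < c := by
    by_contra! hcon
    have heq : ∀ t, 0 < t → f t = c := fun t ht => le_antisymm (hc t ht) (hcon t ht)
    exact hfnt (Or.inl fun t ht => by rw [heq t ht, ← heq 1 one_pos, hf1])
  have hfa := hfpos a ha
  have hΦunb : ∀ K : ℝ, ∃ b, 0 < b ∧ K < Φ b := by
    intro K
    have hK : (0 : ℝ) < (|K| + 1)⁻¹ := by positivity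
    obtain ⟨t, ht, htpos⟩ :=
      ((hΦstar0.eventually (gt_mem_nhds hK)).and self_mem_nhdsWithin).exists
    have htpos : 0 < t⁻¹ := inv_pos.2 htpos
    refine ⟨t⁻¹, htpos, ?_⟩
    have := (inv_lt_inv₀ (hΦpos _ htpos) (by positivity)).1 ht
    linarith [le_abs_self K]
  have hle : c ≤ f a * Φ (c / f a) := by
    refine csSup_le ⟨f 1, 1, mem_Ioi.2 one_pos, rfl⟩ ?_
    rintro _ ⟨s, hs : 0 < s, rfl⟩
    obtain ⟨b, hb, hsb⟩ := hΦunb (s / a)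
    have h1 := hsub.scalar hfpos ha (mul_pos hb ha)
    rw [mul_div_cancel_right₀ _ ha.ne'] at h1
    rw [div_lt_iff₀' ha] at hsb
    refine (hf.monotoneOn hs hsb.le).trans (h1.trans ?_)
    have hfb := hfpos _ (mul_pos hb ha)
    refine mul_le_mul_of_nonneg_left (hΦ.monotoneOn (by positivity) ?_) hfa.le
    exact div_le_div_of_nonneg_right (hc _ (mul_pos hb ha)) hfa.le
  have hx : 1 < c / f a := (one_lt_div hfa).2 hac
  refine hΦnt (Or.inr (hΦ.eq_id hx (le_antisymm ?_ ?_)))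
  · have := hΦ.mul_apply_le_mul_apply one_pos hx.le
    rw [hΦ1] at this
    linarith
  · exact (div_le_iff₀' hfa).2 hle
end

section
/- Let f, Φ ∈ OM_+^1 with Φ(0) = f(0) = 0, and let x, y > 0. Set P = [[1, 0], [0, 0]] and Q = [[x+y, x−y], [x−y, x+y]] (2×2 complex matrices; Q is positive definite). Then P σ_{Φ′} Q = Φ′(4xy/(x+y)) · P, hence f(P σ_{Φ′} Q) = f(Φ′(4xy/(x+y))) · P; moreover f(P) σ_{Φ′} f(Q) = Φ′(2 f(2x) f(2y)/(f(2x) + f(2y))) · P. -/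
open Matrix Filter Set Topology
open scoped ComplexOrder

lemma matFun_smul_add_smul_one_sub {n : ℕ} (g : ℝ → ℝ) (a b : ℝ)
    {E : Matrix (Fin n) (Fin n) ℂ} (hE : IsSelfAdjoint E) (hE' : IsIdempotentElem E) :
    matFun g (a • E + b • (1 - E)) = g a • E + g b • (1 - E) := by
  have hs : spectrum ℝ E ⊆ {0, 1} := hE'.spectrum_subset ℝ
  have hfin : (spectrum ℝ E).Finite := (Set.toFinite {0, 1}).subset hs
  have key : ∀ c d : ℝ, cfc (fun t : ℝ => c * t + d * (1 - t)) E = c • E + d • (1 - E) := by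
    intro c d
    rw [cfc_add .., cfc_const_mul .., cfc_const_mul .., cfc_sub .., cfc_id' ..,
      cfc_const_one ..]
  rw [matFun, ← key a b, ← key (g a) (g b),
    ← cfc_comp' g (fun t : ℝ => a * t + b * (1 - t)) E ((hfin.image _).continuousOn _)]
  refine cfc_congr fun t ht => ?_
  rcases hs ht with rfl | rfl <;> simp

lemma isSelfAdjoint_half_ones :
    IsSelfAdjoint (!![1 / 2, 1 / 2; 1 / 2, 1 / 2] : Matrix (Fin 2) (Fin 2) ℂ) := by
  ext i j
  fin_cases i <;> fin_cases j <;> simp [Matrix.star_apply]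

lemma isIdempotentElem_half_ones :
    IsIdempotentElem (!![1 / 2, 1 / 2; 1 / 2, 1 / 2] : Matrix (Fin 2) (Fin 2) ℂ) := by
  ext i j
  fin_cases i <;> fin_cases j <;> norm_num [Matrix.mul_apply]

/-- The functional calculus of the symmetric matrix with eigenvalues `2 * x` on `(1, 1)` and
`2 * y` on `(1, -1)`. -/
lemma matFun_symm_two (g : ℝ → ℝ) (x y : ℝ) :
    matFun g !![((x + y : ℝ) : ℂ), ((x - y : ℝ) : ℂ); ((x - y : ℝ) : ℂ), ((x + y : ℝ) : ℂ)] =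
      !![((g (2 * x) / 2 + g (2 * y) / 2 : ℝ) : ℂ), ((g (2 * x) / 2 - g (2 * y) / 2 : ℝ) : ℂ);
        ((g (2 * x) / 2 - g (2 * y) / 2 : ℝ) : ℂ), ((g (2 * x) / 2 + g (2 * y) / 2 : ℝ) : ℂ)] := by
  have h := matFun_smul_add_smul_one_sub g (2 * x) (2 * y) isSelfAdjoint_half_ones
    isIdempotentElem_half_ones
  convert h using 1
  · congr 1
    ext i j
    fin_cases i <;> fin_cases j <;> simp <;> ring
  · ext i j
    fin_cases i <;> fin_cases j <;> simp <;> ring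

lemma matFun_smul_of_zero {n : ℕ} {g : ℝ → ℝ} (hg : g 0 = 0) (c : ℝ)
    {E : Matrix (Fin n) (Fin n) ℂ} (hE : IsSelfAdjoint E) (hE' : IsIdempotentElem E) :
    matFun g (c • E) = g c • E := by
  simpa [hg] using matFun_smul_add_smul_one_sub g c 0 hE hE'

lemma isSelfAdjoint_single_two :
    IsSelfAdjoint (!![1, 0; 0, 0] : Matrix (Fin 2) (Fin 2) ℂ) := by
  ext i j
  fin_cases i <;> fin_cases j <;> simp [Matrix.star_apply]

lemma isIdempotentElem_single_two :
    IsIdempotentElem (!![1, 0; 0, 0] : Matrix (Fin 2) (Fin 2) ℂ) := by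
  ext i j
  fin_cases i <;> fin_cases j <;> simp [Matrix.mul_apply]

/-- If `R` and `P` are self-adjoint, `S` is the inverse of `R` and `P * (R * R) * P = c • P`, then
`R * P * R` is `c` times a projection, which `S` conjugates back to `c⁻¹ • P`. -/
lemma conj_matFun_conj {n : ℕ} {Φ : ℝ → ℝ} (hΦ : Φ 0 = 0) {c : ℝ} (hc : c ≠ 0)
    {P R S : Matrix (Fin n) (Fin n) ℂ} (hR : IsSelfAdjoint R) (hP : IsSelfAdjoint P)
    (hSR : S * R = 1) (hPR : P * (R * R) * P = c • P) :
    S * matFun Φ (R * P * R) * S = (c⁻¹ * Φ c) • P := by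
  have hRS : R * S = 1 := mul_eq_one_comm.mp hSR
  have hsa : IsSelfAdjoint (R * P * R) := by
    simp [IsSelfAdjoint, star_mul, hR.star_eq, hP.star_eq, mul_assoc]
  have hsq : R * P * R * (R * P * R) = c • (R * P * R) := by
    calc R * P * R * (R * P * R) = R * (P * (R * R) * P) * R := by noncomm_ring
      _ = c • (R * P * R) := by rw [hPR]; simp
  have hE : IsSelfAdjoint (c⁻¹ • (R * P * R)) := (IsSelfAdjoint.all c⁻¹).smul hsa
  have hE' : IsIdempotentElem (c⁻¹ • (R * P * R)) := by
    rw [IsIdempotentElem, smul_mul_smul_comm, hsq, smul_smul, mul_assoc, inv_mul_cancel₀ hc,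
      mul_one]
  have h := matFun_smul_of_zero hΦ c hE hE'
  rw [smul_smul, mul_inv_cancel₀ hc, one_smul] at h
  have hconj : S * (R * P * R) * S = P := by
    calc S * (R * P * R) * S = (S * R) * P * (R * S) := by noncomm_ring
      _ = P := by rw [hSR, hRS]; simp
  rw [h, Matrix.mul_smul, Matrix.smul_mul, Matrix.mul_smul, Matrix.smul_mul, hconj, smul_smul,
    mul_comm]

lemma kuboMean_symm_two {Φ : ℝ → ℝ} (hΦ : Φ 0 = 0) {x y : ℝ} (hx : 0 < x) (hy : 0 < y) :
    kuboMean Φ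
        !![((x + y : ℝ) : ℂ), ((x - y : ℝ) : ℂ); ((x - y : ℝ) : ℂ), ((x + y : ℝ) : ℂ)]
        !![1, 0; 0, 0] =
      transFun Φ (4 * x * y / (x + y)) • (!![1, 0; 0, 0] : Matrix (Fin 2) (Fin 2) ℂ) := by
  have hs : √(2 * x) ≠ 0 := by positivity
  have ht : √(2 * y) ≠ 0 := by positivity
  have hs2 : (√(2 * x))⁻¹ ^ 2 = (2 * x)⁻¹ := by rw [inv_pow, Real.sq_sqrt (by positivity)]
  have ht2 : (√(2 * y))⁻¹ ^ 2 = (2 * y)⁻¹ := by rw [inv_pow, Real.sq_sqrt (by positivity)]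
  have hc : (4 * x * y / (x + y))⁻¹ ≠ 0 := by positivity
  rw [kuboMean, matFun_symm_two, matFun_symm_two, transFun]
  have h := conj_matFun_conj (S := !![((√(2 * x) / 2 + √(2 * y) / 2 : ℝ) : ℂ),
      ((√(2 * x) / 2 - √(2 * y) / 2 : ℝ) : ℂ); ((√(2 * x) / 2 - √(2 * y) / 2 : ℝ) : ℂ),
      ((√(2 * x) / 2 + √(2 * y) / 2 : ℝ) : ℂ)])
    (R := !![(((√(2 * x))⁻¹ / 2 + (√(2 * y))⁻¹ / 2 : ℝ) : ℂ),
      (((√(2 * x))⁻¹ / 2 - (√(2 * y))⁻¹ / 2 : ℝ) : ℂ);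
      (((√(2 * x))⁻¹ / 2 - (√(2 * y))⁻¹ / 2 : ℝ) : ℂ),
      (((√(2 * x))⁻¹ / 2 + (√(2 * y))⁻¹ / 2 : ℝ) : ℂ)]) hΦ hc ?_ isSelfAdjoint_single_two ?_ ?_
  · rwa [inv_inv] at h
  · ext i j
    fin_cases i <;> fin_cases j <;> simp [Matrix.star_apply]
  · generalize √(2 * x) = s at *
    generalize √(2 * y) = t at *
    have hs' : (s : ℂ) ≠ 0 := by exact_mod_cast hs
    have ht' : (t : ℂ) ≠ 0 := by exact_mod_cast ht
    ext i j
    fin_cases i <;> fin_cases j <;> simp [Matrix.mul_apply, Fin.sum_univ_two] <;>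
      field_simp <;> ring
  · have key : ((√(2 * x))⁻¹ / 2 + (√(2 * y))⁻¹ / 2) * ((√(2 * x))⁻¹ / 2 + (√(2 * y))⁻¹ / 2) +
        ((√(2 * x))⁻¹ / 2 - (√(2 * y))⁻¹ / 2) * ((√(2 * x))⁻¹ / 2 - (√(2 * y))⁻¹ / 2) =
        (4 * x * y / (x + y))⁻¹ := by
      calc _ = ((√(2 * x))⁻¹ ^ 2 + (√(2 * y))⁻¹ ^ 2) / 2 := by ring
        _ = _ := by rw [hs2, ht2]; field_simp; ring
    rw [← key]
    generalize (√(2 * x))⁻¹ = s at *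
    generalize (√(2 * y))⁻¹ = t at *
    ext i j
    fin_cases i <;> fin_cases j <;> simp [Matrix.mul_apply, Fin.sum_univ_two]

theorem stmt_3 (f Φ : ℝ → ℝ) (hf : OMone f) (hΦ : OMone Φ)
    (hf0 : f 0 = 0) (hf0' : Filter.Tendsto f (nhdsWithin 0 (Set.Ioi 0)) (nhds 0))
    (hΦ0 : Φ 0 = 0) (hΦ0' : Filter.Tendsto Φ (nhdsWithin 0 (Set.Ioi 0)) (nhds 0))
    (x y : ℝ) (hx : 0 < x) (hy : 0 < y)
    (P Q : Matrix (Fin 2) (Fin 2) ℂ)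
    (hP : P = !![1, 0; 0, 0])
    (hQ : Q = !![((x + y : ℝ) : ℂ), ((x - y : ℝ) : ℂ); ((x - y : ℝ) : ℂ), ((x + y : ℝ) : ℂ)]) :
    kuboMean Φ Q P = ((transFun Φ (4 * x * y / (x + y)) : ℝ) : ℂ) • P ∧
    matFun f (kuboMean Φ Q P) = ((f (transFun Φ (4 * x * y / (x + y))) : ℝ) : ℂ) • P ∧
    kuboMean Φ (matFun f Q) (matFun f P) =
      ((transFun Φ (2 * f (2 * x) * f (2 * y) / (f (2 * x) + f (2 * y))) : ℝ) : ℂ) • P := by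
  subst hP hQ
  simp only [Complex.coe_smul]
  have hP : matFun f !![1, 0; 0, 0] = (!![1, 0; 0, 0] : Matrix (Fin 2) (Fin 2) ℂ) := by
    simpa [hf.2.1] using
      matFun_smul_of_zero hf0 1 isSelfAdjoint_single_two isIdempotentElem_single_two
  have h := kuboMean_symm_two hΦ0 hx hy
  refine ⟨h, ?_, ?_⟩
  · rw [h]
    exact matFun_smul_of_zero hf0 _ isSelfAdjoint_single_two isIdempotentElem_single_two
  · have hfx : 0 < f (2 * x) := hf.1 _ (by positivity)
    have hfy : 0 < f (2 * y) := hf.1 _ (by positivity)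
    rw [matFun_symm_two, hP, kuboMean_symm_two hΦ0 (half_pos hfx) (half_pos hfy)]
    congr 2
    field_simp
    ring
end

section
/- Let r ∈ ℝ and α ∈ (0,1). If (A #_α B)^r ≤ A^r #_α B^r in the Loewner order for every n ≥ 1 and all n×n complex positive definite matrices A and B, then r ∈ {−1, 0, 1}. -/
open Matrix Filter Set Topology
open scoped ComplexOrder

open scoped MatrixOrder Matrix.Norms.L2Operator

section FunctionalCalculus

variable {n : ℕ} {A B : Matrix (Fin n) (Fin n) ℂ}

theorem continuousOn_real_spectrum (f : ℝ → ℝ) (A : Matrix (Fin n) (Fin n) ℂ) :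
    ContinuousOn f (spectrum ℝ A) :=
  A.finite_real_spectrum.continuousOn f

theorem matFun_isHermitian (f : ℝ → ℝ) (A : Matrix (Fin n) (Fin n) ℂ) :
    (matFun f A).IsHermitian :=
  (cfc_predicate f A : IsSelfAdjoint _)

theorem Matrix.PosDef.spectrum_pos (hA : A.PosDef) : ∀ x ∈ spectrum ℝ A, 0 < x :=
  (StarOrderedRing.isStrictlyPositive_iff_spectrum_pos A hA.isHermitian).1 hA.isStrictlyPositive

theorem Matrix.PosDef.matFun (hA : A.PosDef) {f : ℝ → ℝ} (hf : ∀ x, 0 < x → 0 < f x) :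
    (matFun f A).PosDef :=
  ((cfc_isStrictlyPositive_iff f A (continuousOn_real_spectrum f A) hA.isHermitian).2
    fun x hx => hf x (hA.spectrum_pos x hx)).posDef

theorem matFun_congr (hA : A.PosDef) {f g : ℝ → ℝ} (hfg : ∀ x, 0 < x → f x = g x) :
    matFun f A = matFun g A :=
  cfc_congr fun x hx => hfg x (hA.spectrum_pos x hx)

theorem matFun_matFun (hA : A.IsHermitian) (g f : ℝ → ℝ) :
    matFun g (matFun f A) = matFun (fun x => g (f x)) A :=
  (cfc_comp' g f A ((A.finite_real_spectrum.image f).continuousOn g)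
    (continuousOn_real_spectrum f A) hA).symm

theorem matFun_mul (f g : ℝ → ℝ) :
    matFun f A * matFun g A = matFun (fun x => f x * g x) A :=
  (cfc_mul f g A (continuousOn_real_spectrum f A) (continuousOn_real_spectrum g A)).symm

theorem matFun_one (hA : A.IsHermitian) : matFun (fun _ => 1) A = 1 :=
  cfc_const_one ℝ A hA

theorem inv_matFun (hA : A.PosDef) {f : ℝ → ℝ} (hf : ∀ x, 0 < x → 0 < f x) :
    (matFun f A)⁻¹ = matFun (fun x => (f x)⁻¹) A := by
  refine Matrix.inv_eq_right_inv ?_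
  rw [matFun_mul, ← matFun_one hA.isHermitian]
  exact matFun_congr hA fun x hx => mul_inv_cancel₀ (hf x hx).ne'

theorem inv_eq_matFun (hA : A.PosDef) : A⁻¹ = matFun (fun x => x⁻¹) A := by
  rw [← inv_matFun hA (f := fun x => x) fun x hx => hx]
  congr 1
  exact (cfc_id' ℝ A hA.isHermitian).symm

theorem matFun_inv (hA : A.PosDef) (f : ℝ → ℝ) :
    matFun f A⁻¹ = matFun (fun x => f x⁻¹) A := by
  rw [inv_eq_matFun hA, matFun_matFun hA.isHermitian]

theorem matFun_rpow_inv (hA : A.PosDef) (s : ℝ) :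
    matFun (fun t => t ^ s) A⁻¹ = (matFun (fun t => t ^ s) A)⁻¹ := by
  rw [matFun_inv hA, inv_matFun hA fun x hx => Real.rpow_pos_of_pos hx s]
  exact matFun_congr hA fun x hx => Real.inv_rpow hx.le s

theorem matFun_rpow_inv_eq_neg (hA : A.PosDef) (s : ℝ) :
    matFun (fun t => t ^ s) A⁻¹ = matFun (fun t => t ^ (-s)) A := by
  rw [matFun_inv hA]
  exact matFun_congr hA fun x hx => by rw [Real.inv_rpow hx.le, Real.rpow_neg hx.le]

theorem Matrix.PosDef.mul_mul_self {C : Matrix (Fin n) (Fin n) ℂ} (hC : C.PosDef)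
    (hA : A.PosDef) : (A * C * A).PosDef := by
  have := hC.mul_mul_conjTranspose_same (B := A)
    (Matrix.vecMul_injective_of_isUnit hA.isUnit)
  rwa [hA.isHermitian.eq] at this

theorem conj_inv_sqrt_posDef (hA : A.PosDef) (hB : B.PosDef) :
    (matFun (fun x => (Real.sqrt x)⁻¹) A * B * matFun (fun x => (Real.sqrt x)⁻¹) A).PosDef :=
  hB.mul_mul_self (hA.matFun fun _ hx => inv_pos.2 (Real.sqrt_pos.2 hx))

theorem kuboMean_posDef (hA : A.PosDef) (hB : B.PosDef) {Φ : ℝ → ℝ}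
    (hΦ : ∀ x, 0 < x → 0 < Φ x) : (kuboMean Φ A B).PosDef :=
  ((conj_inv_sqrt_posDef hA hB).matFun hΦ).mul_mul_self
    (hA.matFun fun _ hx => Real.sqrt_pos.2 hx)

theorem kuboMean_rpow_inv (hA : A.PosDef) (hB : B.PosDef) (α : ℝ) :
    kuboMean (fun t => t ^ α) A⁻¹ B⁻¹ = (kuboMean (fun t => t ^ α) A B)⁻¹ := by
  have hsqrt : (matFun Real.sqrt A)⁻¹ = matFun (fun x => (Real.sqrt x)⁻¹) A :=
    inv_matFun hA fun _ hx => Real.sqrt_pos.2 hx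
  have h₁ : matFun Real.sqrt A⁻¹ = matFun (fun x => (Real.sqrt x)⁻¹) A := by
    rw [matFun_inv hA]; simp only [Real.sqrt_inv]
  have h₂ : matFun (fun x => (Real.sqrt x)⁻¹) A⁻¹ = matFun Real.sqrt A := by
    rw [matFun_inv hA]; simp only [Real.sqrt_inv, inv_inv]
  have h₃ : (matFun (fun x => (Real.sqrt x)⁻¹) A)⁻¹ = matFun Real.sqrt A := by
    rw [inv_matFun hA fun _ hx => inv_pos.2 (Real.sqrt_pos.2 hx)]; simp only [inv_inv]
  have h₄ : matFun Real.sqrt A * B⁻¹ * matFun Real.sqrt A =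
      (matFun (fun x => (Real.sqrt x)⁻¹) A * B * matFun (fun x => (Real.sqrt x)⁻¹) A)⁻¹ := by
    rw [Matrix.mul_inv_rev, Matrix.mul_inv_rev, h₃, mul_assoc]
  rw [kuboMean, kuboMean, h₁, h₂, h₄, matFun_rpow_inv (conj_inv_sqrt_posDef hA hB),
    Matrix.mul_inv_rev, Matrix.mul_inv_rev, hsqrt, mul_assoc]

theorem le_of_inv_le_inv_of_posDef (hA : A.PosDef) (hB : B.PosDef) (h : A⁻¹ ≤ B⁻¹) : B ≤ A := by
  have := CStarAlgebra.ringInverse_le_ringInverse h hA.inv.isStrictlyPositive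
  rwa [← Matrix.nonsing_inv_eq_ringInverse, ← Matrix.nonsing_inv_eq_ringInverse,
    Matrix.nonsing_inv_nonsing_inv _ hA.det_pos.ne'.isUnit,
    Matrix.nonsing_inv_nonsing_inv _ hB.det_pos.ne'.isUnit] at this

end FunctionalCalculus

theorem subpreserves_rpow_abs {r α : ℝ}
    (h : Subpreserves (fun t => t ^ α) (fun t => t ^ r)) :
    Subpreserves (fun t => t ^ α) (fun t => t ^ |r|) := by
  rcases abs_choice r with hr | hr
  · rwa [hr]
  · intro n A B hA hB
    have := h n A⁻¹ B⁻¹ hA.inv hB.inv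
    rwa [kuboMean_rpow_inv hA hB, matFun_rpow_inv_eq_neg hA, matFun_rpow_inv_eq_neg hB,
      matFun_rpow_inv_eq_neg (kuboMean_posDef hA hB fun x hx => Real.rpow_pos_of_pos hx α),
      ← hr] at this

theorem Subpreserves.preservesMean_rpow {s α : ℝ}
    (h : Subpreserves (fun t => t ^ α) (fun t => t ^ s)) :
    PreservesMean (fun t => t ^ α) (fun t => t ^ s) := by
  intro n A B hA hB
  have hpos (a x : ℝ) (hx : 0 < x) : 0 < x ^ a := Real.rpow_pos_of_pos hx a
  have hK := kuboMean_posDef hA hB (hpos α)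
  have hAs := hA.matFun (hpos s)
  have hBs := hB.matFun (hpos s)
  have hinv := h n A⁻¹ B⁻¹ hA.inv hB.inv
  rw [kuboMean_rpow_inv hA hB, matFun_rpow_inv hA, matFun_rpow_inv hB, matFun_rpow_inv hK,
    kuboMean_rpow_inv hAs hBs] at hinv
  exact le_antisymm (h n A B hA hB)
    (le_of_inv_le_inv_of_posDef (hK.matFun (hpos s)) (kuboMean_posDef hAs hBs (hpos α)) hinv)

section Continuity

variable {n : ℕ} {X : Type*} [TopologicalSpace X]

theorem Continuous.matFun {f : ℝ → ℝ} (hf : Continuous f) {a : X → Matrix (Fin n) (Fin n) ℂ}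
    (ha : Continuous a) (ha' : ∀ x, (a x).IsHermitian) :
    Continuous fun x => matFun f (a x) :=
  Continuous.cfc_of_mem_nhdsSet (s := Set.univ) f Filter.univ_mem ha ha' hf.continuousOn

theorem Continuous.kuboMean {Φ : ℝ → ℝ} (hΦ : Continuous Φ) (A : Matrix (Fin n) (Fin n) ℂ)
    {b : X → Matrix (Fin n) (Fin n) ℂ} (hb : Continuous b) (hb' : ∀ x, (b x).IsHermitian) :
    Continuous fun x => kuboMean Φ A (b x) := by
  refine (continuous_const.mul (hΦ.matFun ((continuous_const.mul hb).mul continuous_const)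
    fun x => ?_)).mul continuous_const
  have := Matrix.isHermitian_conjTranspose_mul_mul (_root_.matFun (fun x => (Real.sqrt x)⁻¹) A)
    (hb' x)
  rwa [(matFun_isHermitian _ A).eq] at this

theorem kuboMean_isHermitian (Φ : ℝ → ℝ) (A B : Matrix (Fin n) (Fin n) ℂ) :
    (kuboMean Φ A B).IsHermitian := by
  have := Matrix.isHermitian_conjTranspose_mul_mul (matFun Real.sqrt A)
    (matFun_isHermitian Φ (matFun (fun x => (Real.sqrt x)⁻¹) A * B *
      matFun (fun x => (Real.sqrt x)⁻¹) A))
  rwa [(matFun_isHermitian _ A).eq] at this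

theorem PreservesMean.of_posSemidef {Φ f : ℝ → ℝ} (hΦ : Continuous Φ) (hf : Continuous f)
    (h : PreservesMean Φ f) {A B : Matrix (Fin n) (Fin n) ℂ} (hA : A.PosDef)
    (hB : B.PosSemidef) :
    matFun f (_root_.kuboMean Φ A B) = _root_.kuboMean Φ (matFun f A) (matFun f B) := by
  have hb : Continuous fun ε : ℝ => B + ε • (1 : Matrix (Fin n) (Fin n) ℂ) := by fun_prop
  have hb' (ε : ℝ) : (B + ε • (1 : Matrix (Fin n) (Fin n) ℂ)).IsHermitian :=
    hB.isHermitian.add ((IsSelfAdjoint.all ε).smul (IsSelfAdjoint.one (Matrix (Fin n) (Fin n) ℂ)))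
  have h₁ := hf.matFun (hΦ.kuboMean A hb hb') fun ε => kuboMean_isHermitian Φ A _
  have h₂ := hΦ.kuboMean (_root_.matFun f A) (hf.matFun hb hb') fun ε => matFun_isHermitian f _
  have heq := tendsto_nhds_unique_of_eventuallyEq
    ((h₁.tendsto 0).mono_left (nhdsWithin_le_nhds (s := Set.Ioi 0)))
    ((h₂.tendsto 0).mono_left (nhdsWithin_le_nhds (s := Set.Ioi 0)))
    (by
      filter_upwards [self_mem_nhdsWithin] with ε hε
      exact h n A _ hA (Matrix.PosDef.posSemidef_add hB (Matrix.PosDef.one.smul hε)))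
  simpa using heq

end Continuity

section Projections

variable {n : ℕ}

theorem matFun_smul_add_smul {P : Matrix (Fin n) (Fin n) ℂ} (hP : P.IsHermitian)
    (hPP : P * P = P) (f : ℝ → ℝ) (a b : ℝ) :
    matFun f (a • P + b • (1 - P)) = f a • P + f b • (1 - P) := by
  have key (a b : ℝ) : matFun (fun x => a * x + b * (1 - x)) P = a • P + b • (1 - P) := by
    have : (cfc (fun x : ℝ => a * x + b * (1 - x)) P) = a • P + b • (1 - P) := by
      have hP' : IsSelfAdjoint P := hP
      rw [cfc_add .., cfc_const_mul .., cfc_const_mul .., cfc_sub .., cfc_id' ℝ P,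
        cfc_const_one ℝ P]
    exact this
  rw [← key a b, matFun_matFun hP, ← key (f a) (f b)]
  refine cfc_congr fun x hx => ?_
  have hx' : x = 0 ∨ x = 1 := by
    simpa using IsIdempotentElem.spectrum_subset ℝ (p := P) hPP hx
  rcases hx' with rfl | rfl <;> simp

theorem matFun_smul_projection {P : Matrix (Fin n) (Fin n) ℂ} (hP : P.IsHermitian)
    (hPP : P * P = P) {f : ℝ → ℝ} (hf : f 0 = 0) (a : ℝ) :
    matFun f (a • P) = f a • P := by
  simpa [hf] using matFun_smul_add_smul hP hPP f a 0

end Projections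

section TwoByTwo

theorem matFun_diag (f : ℝ → ℝ) (a b : ℝ) :
    matFun f !![(a : ℂ), 0; 0, (b : ℂ)] = !![(f a : ℂ), 0; 0, (f b : ℂ)] := by
  have key (a b : ℝ) : !![(a : ℂ), 0; 0, (b : ℂ)] =
      a • !![(1 : ℂ), 0; 0, 0] + b • (1 - !![(1 : ℂ), 0; 0, 0]) := by
    ext i j; fin_cases i <;> fin_cases j <;> simp
  rw [key, key, matFun_smul_add_smul]
  · ext i j; fin_cases i <;> fin_cases j <;> simp
  · ext i j; fin_cases i <;> fin_cases j <;> simp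

/-- The orthogonal projection onto the span of `(1, 1)`. -/
noncomputable def diagonalProjection : Matrix (Fin 2) (Fin 2) ℂ := !![1 / 2, 1 / 2; 1 / 2, 1 / 2]

theorem diagonalProjection_isHermitian : diagonalProjection.IsHermitian := by
  ext i j; fin_cases i <;> fin_cases j <;> simp [diagonalProjection]

theorem diagonalProjection_mul_self :
    diagonalProjection * diagonalProjection = diagonalProjection := by
  ext i j; fin_cases i <;> fin_cases j <;> norm_num [diagonalProjection]

theorem matFun_smul_diagonalProjection {f : ℝ → ℝ} (hf : f 0 = 0) (a : ℝ) :
    matFun f (a • diagonalProjection) = f a • diagonalProjection :=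
  matFun_smul_projection diagonalProjection_isHermitian diagonalProjection_mul_self hf a

theorem kuboMean_diag_diagonalProjection {α a : ℝ} (hα : α ≠ 0) (ha : 0 < a) :
    kuboMean (fun t => t ^ α) !![(a : ℂ), 0; 0, ((1 : ℝ) : ℂ)] diagonalProjection =
      ((a⁻¹ + 1) / 2) ^ (α - 1) • diagonalProjection := by
  obtain ⟨u, hu, rfl⟩ : ∃ u : ℝ, 0 < u ∧ a = u ^ 2 :=
    ⟨√a, Real.sqrt_pos.2 ha, (Real.sq_sqrt ha.le).symm⟩
  have hk : 0 < ((u ^ 2)⁻¹ + 1) / 2 := by positivity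
  have huC : (u : ℂ) ≠ 0 := by exact_mod_cast hu.ne'
  have hu1 : 1 + (u : ℂ) ^ 2 ≠ 0 := by
    have : (1 : ℝ) + u ^ 2 ≠ 0 := by positivity
    exact_mod_cast this
  set R : Matrix (Fin 2) (Fin 2) ℂ :=
    !![1 / (1 + (u : ℂ) ^ 2), u / (1 + (u : ℂ) ^ 2);
      u / (1 + (u : ℂ) ^ 2), (u : ℂ) ^ 2 / (1 + (u : ℂ) ^ 2)] with hR
  have hRH : R.IsHermitian := by
    ext i j; fin_cases i <;> fin_cases j <;> simp [hR]
  have hRR : R * R = R := by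
    ext i j; fin_cases i <;> fin_cases j <;> simp [hR] <;> field_simp
  have hC : !![((u⁻¹ : ℝ) : ℂ), 0; 0, (((1 : ℝ)⁻¹ : ℝ) : ℂ)] * diagonalProjection *
      !![((u⁻¹ : ℝ) : ℂ), 0; 0, (((1 : ℝ)⁻¹ : ℝ) : ℂ)] = (((u ^ 2)⁻¹ + 1) / 2) • R := by
    ext i j; fin_cases i <;> fin_cases j <;> simp [hR, diagonalProjection] <;> field_simp
  rw [kuboMean, matFun_diag, matFun_diag, Real.sqrt_one, Real.sqrt_sq hu.le, hC,
    matFun_smul_projection hRH hRR (f := fun t => t ^ α) (Real.zero_rpow hα),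
    Real.rpow_sub hk, Real.rpow_one]
  generalize (((u ^ 2)⁻¹ + 1) / 2) ^ α = c
  ext i j; fin_cases i <;> fin_cases j <;> simp [hR, diagonalProjection] <;> field_simp

end TwoByTwo

theorem rpow_exponent_eq_one_of_midpoint {r x : ℝ} (hr : 0 < r) (hx : 0 < x) (hx1 : x ≠ 1)
    (h : ((x + 1) / 2) ^ r = (x ^ r + 1) / 2) : r = 1 := by
  rcases lt_trichotomy r 1 with hlt | heq | hgt
  · have := (Real.strictConcaveOn_rpow hr hlt).2 hx.le (Set.mem_Ici.2 zero_le_one) hx1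
      (by norm_num : (0 : ℝ) < 1 / 2) (by norm_num : (0 : ℝ) < 1 / 2) (by norm_num)
    simp only [smul_eq_mul, Real.one_rpow] at this
    rw [show (1 / 2 * x + 1 / 2 * 1 : ℝ) = (x + 1) / 2 by ring] at this
    linarith
  · exact heq
  · have := (strictConvexOn_rpow hgt).2 hx.le (Set.mem_Ici.2 zero_le_one) hx1
      (by norm_num : (0 : ℝ) < 1 / 2) (by norm_num : (0 : ℝ) < 1 / 2) (by norm_num)
    simp only [smul_eq_mul, Real.one_rpow] at this
    rw [show (1 / 2 * x + 1 / 2 * 1 : ℝ) = (x + 1) / 2 by ring] at this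
    linarith

theorem PreservesMean.rpow_exponent_eq_one {s α : ℝ} (hα : α ∈ Set.Ioo (0 : ℝ) 1) (hs : 0 < s)
    (h : PreservesMean (fun t => t ^ α) (fun t => t ^ s)) : s = 1 := by
  have hA : (!![((2 : ℝ) : ℂ), 0; 0, ((1 : ℝ) : ℂ)]).PosDef := by
    have : !![((2 : ℝ) : ℂ), 0; 0, ((1 : ℝ) : ℂ)] = Matrix.diagonal ![2, 1] := by
      ext i j; fin_cases i <;> fin_cases j <;> simp
    rw [this, Matrix.posDef_diagonal_iff]
    intro i; fin_cases i <;> simp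
  have hP : diagonalProjection.PosSemidef := by
    have := Matrix.posSemidef_conjTranspose_mul_self diagonalProjection
    rwa [diagonalProjection_isHermitian.eq, diagonalProjection_mul_self] at this
  have key := h.of_posSemidef (Real.continuous_rpow_const hα.1.le)
    (Real.continuous_rpow_const hs.le) hA hP
  have hPs : matFun (fun t => t ^ s) diagonalProjection = diagonalProjection := by
    simpa using matFun_smul_diagonalProjection (f := fun t => t ^ s) (Real.zero_rpow hs.ne') 1
  rw [kuboMean_diag_diagonalProjection hα.1.ne' two_pos,
    matFun_smul_diagonalProjection (f := fun t => t ^ s) (Real.zero_rpow hs.ne'), matFun_diag,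
    Real.one_rpow, hPs,
    kuboMean_diag_diagonalProjection hα.1.ne' (by positivity)] at key
  have key' := congrFun (congrFun key 0) 0
  simp only [diagonalProjection, Matrix.smul_apply, Complex.real_smul] at key'
  have hne : α - 1 ≠ 0 := by linarith [hα.2]
  refine rpow_exponent_eq_one_of_midpoint (x := 2⁻¹) hs (by norm_num) (by norm_num) ?_
  rw [Real.inv_rpow two_pos.le]
  refine (Real.rpow_left_inj (by positivity) (by positivity) hne).1 ?_
  rw [← Real.rpow_mul (by positivity), mul_comm s, Real.rpow_mul (by positivity)]
  have h2 := mul_right_cancel₀ (by simp) key'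
  exact_mod_cast h2

theorem stmt_5 (r α : ℝ) (hα : α ∈ Set.Ioo (0 : ℝ) 1)
    (h : ∀ (n : ℕ) (A B : Matrix (Fin n) (Fin n) ℂ), A.PosDef → B.PosDef →
      loewnerLE (matFun (fun t => t ^ r) (kuboMean (fun t => t ^ α) A B))
        (kuboMean (fun t => t ^ α) (matFun (fun t => t ^ r) A) (matFun (fun t => t ^ r) B))) :
    r = -1 ∨ r = 0 ∨ r = 1 := by
  rcases eq_or_ne r 0 with hr | hr
  · exact Or.inr (Or.inl hr)
  · have hs : |r| = 1 :=
      (subpreserves_rpow_abs h).preservesMean_rpow.rpow_exponent_eq_one hα (abs_pos.2 hr)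
    rcases eq_or_eq_neg_of_abs_eq hs with h1 | h1
    · exact Or.inr (Or.inr h1)
    · exact Or.inl h1
end

section
/- Let Φ ∈ OM_+^1 be non-trivial with Φ(0) + Φ′(0) > 0. If f ∈ OM_+^1 is σ_Φ-subpreserving and f(0) = 0, then f(t) = t for all t ∈ [0,∞). -/
open Matrix Filter Set Topology
open scoped ComplexOrder

/-- Real functional calculus of a unitarily diagonalised matrix. -/
lemma matFun_conj_diagonal {n : ℕ} (f : ℝ → ℝ) (U : Matrix.unitaryGroup (Fin n) ℂ)
    (d : Fin n → ℝ) :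
    matFun f ((U : Matrix (Fin n) (Fin n) ℂ) * diagonal (fun i => (d i : ℂ)) *
        star (U : Matrix (Fin n) (Fin n) ℂ)) =
      (U : Matrix (Fin n) (Fin n) ℂ) * diagonal (fun i => (f (d i) : ℂ)) *
        star (U : Matrix (Fin n) (Fin n) ℂ) := by
  set A := (U : Matrix (Fin n) (Fin n) ℂ) * diagonal (fun i => (d i : ℂ)) *
        star (U : Matrix (Fin n) (Fin n) ℂ) with hA
  have hAsa : IsSelfAdjoint A := by
    rw [isSelfAdjoint_iff, hA, star_mul, star_mul, star_star, mul_assoc]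
    congr 2
    simp [star_eq_conjTranspose, diagonal_conjTranspose, Pi.star_def]
  classical
  have hfin : (spectrum ℝ A).Finite := Matrix.finite_real_spectrum
  let S : Finset ℝ := hfin.toFinset ∪ Finset.univ.image d
  let p : Polynomial ℝ := Lagrange.interpolate S id f
  have hp : ∀ x ∈ S, p.eval x = f x := fun x hx =>
    Lagrange.eval_interpolate_at_node f (Function.injective_id.injOn) hx
  have h₁ : matFun f A = Polynomial.aeval A p := by
    rw [matFun, ← cfc_polynomial p A hAsa]
    refine cfc_congr fun x hx => (hp x ?_).symm
    simp [S, hx]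
  let φ : (Fin n → ℂ) →ₐ[ℝ] Matrix (Fin n) (Fin n) ℂ :=
    ((Unitary.conjStarAlgAut ℝ (Matrix (Fin n) (Fin n) ℂ) U).toAlgEquiv.toAlgHom).comp
      (Matrix.diagonalAlgHom ℝ)
  have hφ : ∀ v, φ v = (U : Matrix (Fin n) (Fin n) ℂ) * diagonal v *
      star (U : Matrix (Fin n) (Fin n) ℂ) := fun v => rfl
  have h₂ : Polynomial.aeval (fun i => (d i : ℂ)) p = fun i => (f (d i) : ℂ) := by
    funext i
    rw [← hp (d i) (by simp [S])]
    have := Polynomial.aeval_algHom_apply (Pi.evalAlgHom ℝ (fun _ : Fin n => ℂ) i)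
      (fun i => (d i : ℂ)) p
    simp only [Pi.evalAlgHom_apply] at this
    rw [← this]
    exact Polynomial.aeval_algebraMap_apply_eq_algebraMap_eval (A := ℂ) (d i) p
  rw [h₁, hA, ← hφ, Polynomial.aeval_algHom_apply, h₂, hφ]

lemma matFun_diagonal {n : ℕ} (f : ℝ → ℝ) (d : Fin n → ℝ) :
    matFun f (diagonal (fun i => (d i : ℂ))) = diagonal (fun i => (f (d i) : ℂ)) := by
  simpa using matFun_conj_diagonal f 1 d

lemma matFun_algebraMap {n : ℕ} (f : ℝ → ℝ) (x : ℝ) :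
    matFun f (algebraMap ℝ (Matrix (Fin n) (Fin n) ℂ) x) = algebraMap ℝ _ (f x) :=
  cfc_algebraMap x f

lemma posDef_algebraMap {x : ℝ} (hx : 0 < x) :
    (algebraMap ℝ (Matrix (Fin 1) (Fin 1) ℂ) x).PosDef := by
  rw [Matrix.algebraMap_eq_diagonal]
  exact PosDef.diagonal fun i => by simpa using hx

lemma loewnerLE_algebraMap {x y : ℝ} :
    loewnerLE (algebraMap ℝ (Matrix (Fin 1) (Fin 1) ℂ) x) (algebraMap ℝ _ y) ↔ x ≤ y := by
  rw [loewnerLE, ← map_sub, Matrix.algebraMap_eq_diagonal, posSemidef_diagonal_iff]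
  simp [-Complex.ofReal_sub]

lemma kuboMean_algebraMap (Φ : ℝ → ℝ) {x : ℝ} (hx : 0 < x) (y : ℝ) :
    kuboMean Φ (algebraMap ℝ (Matrix (Fin 1) (Fin 1) ℂ) x) (algebraMap ℝ _ y) =
      algebraMap ℝ _ (x * Φ (y / x)) := by
  simp only [kuboMean, matFun_algebraMap, ← map_mul]
  have h := Real.mul_self_sqrt hx.le
  have h0 : √x ≠ 0 := (Real.sqrt_pos.2 hx).ne'
  have h1 : (√x)⁻¹ * y * (√x)⁻¹ = y / x := by
    nth_rewrite 3 [← h]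
    field_simp
  rw [h1, mul_right_comm, h]

lemma Subpreserves.scalar_le {Φ f : ℝ → ℝ} (h : Subpreserves Φ f)
    (hf : ∀ t : ℝ, 0 < t → 0 < f t) {x y : ℝ} (hx : 0 < x) (hy : 0 < y) :
    f (x * Φ (y / x)) ≤ f x * Φ (f y / f x) := by
  have := h 1 _ _ (posDef_algebraMap hx) (posDef_algebraMap hy)
  rwa [kuboMean_algebraMap Φ hx, matFun_algebraMap, matFun_algebraMap, matFun_algebraMap,
    kuboMean_algebraMap Φ (hf x hx), loewnerLE_algebraMap] at this

lemma OpMonotone.monotone_s6 {f : ℝ → ℝ} (h : OpMonotone f) {x y : ℝ} (hx : 0 < x) (hxy : x ≤ y) :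
    f x ≤ f y := by
  have := h 1 _ _ (posDef_algebraMap hx) (posDef_algebraMap (hx.trans_le hxy))
    (loewnerLE_algebraMap.2 hxy)
  rwa [matFun_algebraMap, matFun_algebraMap, loewnerLE_algebraMap] at this

/-- Comparison of a rotated diagonal `2 × 2` matrix with a diagonal one gives concavity up to an
arbitrarily small shift of the argument. -/
lemma OpMonotone.combo_le {f : ℝ → ℝ} (h : OpMonotone f) {s t p q ε : ℝ} (hs : 0 < s) (ht : 0 < t)
    (hpq : p ^ 2 + q ^ 2 = 1) (hε : 0 < ε) :
    p ^ 2 * f s + q ^ 2 * f t ≤ f (p ^ 2 * s + q ^ 2 * t + ε) := by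
  have hpqC : (p : ℂ) ^ 2 + (q : ℂ) ^ 2 = 1 := by exact_mod_cast hpq
  let V : Matrix (Fin 2) (Fin 2) ℂ := !![(p : ℂ), q; -q, p]
  have hstar : star V = !![(p : ℂ), -q; q, p] := by
    ext i j
    fin_cases i <;> fin_cases j <;> simp [V]
  have hV : V ∈ Matrix.unitaryGroup (Fin 2) ℂ := by
    rw [Matrix.mem_unitaryGroup_iff, hstar, Matrix.mul_fin_two, Matrix.one_fin_two]
    congr 1
    ext i j
    fin_cases i <;> fin_cases j <;> simp <;> first | ring1 | linear_combination hpqC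
  have hconj : ∀ v : Fin 2 → ℝ, V * Matrix.diagonal (fun i => (v i : ℂ)) * star V =
      !![(p : ℂ) ^ 2 * v 0 + q ^ 2 * v 1, p * q * (v 1 - v 0);
        p * q * (v 1 - v 0), q ^ 2 * v 0 + p ^ 2 * v 1] := by
    intro v
    rw [hstar, Matrix.diagonal_fin_two, Matrix.mul_fin_two, Matrix.mul_fin_two]
    ext i j
    fin_cases i <;> fin_cases j <;> simp <;> ring
  let U : Matrix.unitaryGroup (Fin 2) ℂ := ⟨V, hV⟩
  let k : ℝ := p * q * (t - s)
  let C : ℝ := q ^ 2 * s + p ^ 2 * t + k ^ 2 / ε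
  have hC : 0 < C := by
    have h1 : 0 < q ^ 2 * s + p ^ 2 * t := by
      rcases eq_or_ne q 0 with rfl | hq
      · have : p ^ 2 = 1 := by simpa using hpq
        simpa [this] using ht
      · have := sq_pos_of_ne_zero hq
        positivity
    positivity
  have hm : 0 < p ^ 2 * s + q ^ 2 * t + ε := by positivity
  let A : Matrix (Fin 2) (Fin 2) ℂ := V * diagonal (fun i => ((![s, t] i : ℝ) : ℂ)) * star V
  let B : Matrix (Fin 2) (Fin 2) ℂ :=
    diagonal (fun i => ((![p ^ 2 * s + q ^ 2 * t + ε, C] i : ℝ) : ℂ))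
  have hB : B.PosDef := PosDef.diagonal fun i => by
    fin_cases i
    · simpa using (Complex.zero_lt_real.2 hm)
    · simpa using hC
  have hA : A.PosDef := by
    have hD : (diagonal (fun i => ((![s, t] i : ℝ) : ℂ))).PosDef := PosDef.diagonal fun i => by
      fin_cases i
      · simpa using hs
      · simpa using ht
    refine hD.mul_mul_conjTranspose_same (B := V) ?_
    exact Matrix.vecMul_injective_of_isUnit (Unitary.isUnit_coe (U := U))
  have hεC : (ε : ℂ) ≠ 0 := by exact_mod_cast hε.ne'
  have hAB : loewnerLE A B := by
    have hBA : B - A = (ε : ℂ) • vecMulVec ![1, -(k / ε : ℂ)] (star ![1, -(k / ε : ℂ)]) := by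
      simp only [A, B, hconj, Matrix.diagonal_fin_two]
      ext i j
      fin_cases i <;> fin_cases j <;>
        simp [C, k, -cons_vecMulVec, vecMulVec_apply] <;> field_simp
    rw [loewnerLE, hBA]
    exact (posSemidef_vecMulVec_self_star _).smul (by simpa using hε.le)
  have key := h 2 A B hA hB hAB
  have e1 : matFun f A = V * diagonal (fun i => ((f (![s, t] i) : ℝ) : ℂ)) * star V :=
    matFun_conj_diagonal f U ![s, t]
  have e2 : matFun f B = _ := matFun_diagonal f ![p ^ 2 * s + q ^ 2 * t + ε, C]
  rw [loewnerLE, e1, e2] at key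
  have h00 := key.diag_nonneg (i := 0)
  have e3 : (0 : ℂ) ≤ ((f (p ^ 2 * s + q ^ 2 * t + ε) - (p ^ 2 * f s + q ^ 2 * f t) : ℝ) : ℂ) := by
    convert h00 using 1
    rw [hconj]
    simp
  exact sub_nonneg.1 (Complex.zero_le_real.1 e3)

/-- A positive-half-line operator monotone function is concave. -/
lemma OpMonotone.concaveOn {f : ℝ → ℝ} (h : OpMonotone f) : ConcaveOn ℝ (Ioi 0) f := by
  refine LinearOrder.concaveOn_of_lt (convex_Ioi 0) ?_
  intro s hs t ht hst a b ha hb hab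
  simp only [smul_eq_mul, mem_Ioi] at *
  have hlim : Tendsto (fun c : ℝ => (1 - c) * f s + c * f t) (𝓝[<] b)
      (𝓝 ((1 - b) * f s + b * f t)) := by
    refine Tendsto.mono_left ?_ nhdsWithin_le_nhds
    exact Continuous.tendsto (by fun_prop) b
  obtain rfl : a = 1 - b := by linarith
  refine le_of_tendsto hlim ?_
  filter_upwards [Ioo_mem_nhdsLT hb] with c hc
  have h1 : 0 ≤ 1 - c := by linarith [hc.2]
  have := h.combo_le (p := √(1 - c)) (q := √c) (ε := (b - c) * (t - s)) hs ht
    (by rw [Real.sq_sqrt h1, Real.sq_sqrt hc.1.le]; ring)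
    (mul_pos (sub_pos.2 hc.2) (sub_pos.2 hst))
  rw [Real.sq_sqrt h1, Real.sq_sqrt hc.1.le] at this
  rwa [show (1 - c) * s + c * t + (b - c) * (t - s) = (1 - b) * s + b * t by ring] at this

lemma ConcaveOn.mul_le_of_pos {f : ℝ → ℝ} (hc : ConcaveOn ℝ (Ioi 0) f)
    (hpos : ∀ t : ℝ, 0 < t → 0 < f t) {c t : ℝ} (hc0 : 0 < c) (hc1 : c ≤ 1) (ht : 0 < t) :
    c * f t ≤ f (c * t) := by
  rcases hc1.eq_or_lt with rfl | hc1
  · simp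
  have hlim : Tendsto (fun a : ℝ => a * f t) (𝓝[<] c) (𝓝 (c * f t)) :=
    Tendsto.mono_left (Continuous.tendsto (by fun_prop) c) nhdsWithin_le_nhds
  refine le_of_tendsto hlim ?_
  filter_upwards [Ioo_mem_nhdsLT hc0] with a ha
  have ha1 : 0 < 1 - a := by linarith [ha.2]
  have hδ : 0 < (c - a) * t / (1 - a) := div_pos (mul_pos (sub_pos.2 ha.2) ht) ha1
  have := hc.2 (mem_Ioi.2 ht) (mem_Ioi.2 hδ) ha.1.le ha1.le (by ring)
  simp only [smul_eq_mul] at this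
  rw [mul_div_cancel₀ _ ha1.ne', ← add_mul, add_sub_cancel] at this
  exact le_trans (le_add_of_nonneg_right (mul_nonneg ha1.le (hpos _ hδ).le)) this

lemma ConcaveOn.add_transFun_le {f : ℝ → ℝ} (hc : ConcaveOn ℝ (Ioi 0) f) (h1 : f 1 = 1)
    {t : ℝ} (ht : 0 < t) : f t + transFun f t ≤ 1 + t := by
  have := hc.2 (mem_Ioi.2 ht) (mem_Ioi.2 (inv_pos.2 ht))
    (show 0 ≤ 1 / (1 + t) by positivity) (show 0 ≤ t / (1 + t) by positivity) (by field_simp)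
  simp only [smul_eq_mul] at this
  rw [show 1 / (1 + t) * t + t / (1 + t) * t⁻¹ = 1 by field_simp; ring, h1] at this
  rw [transFun]
  have e : 1 / (1 + t) * f t + t / (1 + t) * f t⁻¹ = (f t + t * f t⁻¹) / (1 + t) := by ring
  rw [e, div_le_one (by positivity)] at this
  exact this

/-- Sub-homogeneity for one ratio `c < 1` forces a normalised positive concave function to be the
identity. -/
lemma ConcaveOn.eq_id_of_le_mul {f : ℝ → ℝ} (hc : ConcaveOn ℝ (Ioi 0) f)
    (hpos : ∀ t : ℝ, 0 < t → 0 < f t) (h1 : f 1 = 1) {c : ℝ} (hc0 : 0 < c) (hc1 : c < 1)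
    (h : ∀ t : ℝ, 0 < t → f (c * t) ≤ c * f t) {t : ℝ} (ht : 0 < t) : f t = t := by
  have hpow : ∀ (k : ℕ) (x : ℝ), 0 < x → f (c ^ k * x) ≤ c ^ k * f x := by
    intro k x hx
    induction k with
    | zero => simp
    | succ k ih =>
      rw [pow_succ', mul_assoc, mul_assoc]
      exact (h _ (by positivity)).trans (mul_le_mul_of_nonneg_left ih hc0.le)
  have hle : ∀ x : ℝ, 0 < x → f x ≤ x := by
    intro x hx
    obtain ⟨k, hk⟩ := exists_pow_lt_of_lt_one hx hc1
    have hk0 : 0 < c ^ k := by positivity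
    have h2 := hc.mul_le_of_pos hpos (c := c ^ k / x) (by positivity)
      ((div_le_one hx).2 hk.le) hx
    have h3 := hpow k 1 one_pos
    rw [div_mul_cancel₀ _ hx.ne'] at h2
    rw [mul_one, h1, mul_one] at h3
    have h4 := h2.trans h3
    rw [div_mul_eq_mul_div, div_le_iff₀ hx] at h4
    exact le_of_mul_le_mul_left h4 hk0
  refine le_antisymm (hle t ht) ?_
  obtain ⟨k, hk⟩ := exists_pow_lt_of_lt_one (inv_pos.2 ht) hc1
  have hk0 : 0 < c ^ k := by positivity
  have hk1 : c ^ k * t ≤ 1 := by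
    have := mul_le_mul_of_nonneg_right hk.le ht.le
    rwa [inv_mul_cancel₀ ht.ne'] at this
  have h2 := hc.mul_le_of_pos hpos (c := c ^ k * t) (by positivity) hk1 one_pos
  rw [h1, mul_one] at h2
  exact le_of_mul_le_mul_left (h2.trans (hpow k t ht)) hk0

lemma le_mul_of_tendsto_of_subpreserving {f Ψ : ℝ → ℝ} (hf : ConcaveOn ℝ (Ioi 0) f)
    (hpos : ∀ t : ℝ, 0 < t → 0 < f t) (hf0 : Tendsto f (𝓝[>] 0) (𝓝 0)) {c : ℝ} (hc : 0 < c)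
    (hΨ : Tendsto Ψ (𝓝[>] 0) (𝓝 c))
    (h : ∀ x y : ℝ, 0 < x → 0 < y → f (x * Ψ (y / x)) ≤ f x * Ψ (f y / f x))
    {x : ℝ} (hx : 0 < x) : f (c * x) ≤ c * f x := by
  have hdiv : ∀ {g : ℝ → ℝ} {r : ℝ}, 0 < r → (∀ t, 0 < t → 0 < g t) →
      Tendsto g (𝓝[>] 0) (𝓝 0) → Tendsto (fun y => g y / r) (𝓝[>] 0) (𝓝[>] 0) := by
    intro g r hr hg hg0
    refine tendsto_nhdsWithin_iff.2 ⟨by simpa using hg0.div_const r, ?_⟩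
    filter_upwards [self_mem_nhdsWithin] with y hy
    exact div_pos (hg y hy) hr
  have hcont : ContinuousAt f (x * c) :=
    (hf.continuousOn isOpen_Ioi).continuousAt (Ioi_mem_nhds (mul_pos hx hc))
  have hl : Tendsto (fun y => f (x * Ψ (y / x))) (𝓝[>] 0) (𝓝 (f (x * c))) :=
    hcont.tendsto.comp ((hΨ.comp (hdiv hx (fun _ h => h)
      (tendsto_id.mono_left nhdsWithin_le_nhds))).const_mul x)
  have hr : Tendsto (fun y => f x * Ψ (f y / f x)) (𝓝[>] 0) (𝓝 (f x * c)) :=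
    (hΨ.comp (hdiv (hpos x hx) hpos hf0)).const_mul (f x)
  rw [mul_comm c, mul_comm c]
  refine le_of_tendsto_of_tendsto hl hr ?_
  filter_upwards [self_mem_nhdsWithin] with y hy
  exact h x y hx hy

lemma le_of_tendsto_nhdsGT_of_monotone {g : ℝ → ℝ} {c : ℝ} (hg : Tendsto g (𝓝[>] 0) (𝓝 c))
    (hmono : ∀ x y : ℝ, 0 < x → x ≤ y → g x ≤ g y) {t : ℝ} (ht : 0 < t) : c ≤ g t := by
  refine le_of_tendsto hg ?_
  filter_upwards [Ioo_mem_nhdsGT ht] with y hy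
  exact hmono y t hy.1 hy.2.le

lemma ConcaveOn.transFun_le {f : ℝ → ℝ} (hc : ConcaveOn ℝ (Ioi 0) f)
    (hpos : ∀ t : ℝ, 0 < t → 0 < f t) {x y : ℝ} (hx : 0 < x) (hxy : x ≤ y) :
    transFun f x ≤ transFun f y := by
  have hy := hx.trans_le hxy
  have := hc.mul_le_of_pos hpos (c := x / y) (div_pos hx hy) ((div_le_one hy).2 hxy)
    (inv_pos.2 hx)
  rw [show x / y * x⁻¹ = y⁻¹ by field_simp, div_mul_eq_mul_div, div_le_iff₀ hy] at this
  simpa [transFun, mul_comm y] using this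

theorem stmt_6 (f Φ : ℝ → ℝ) (hΦ : OMone Φ) (hΦnt : ¬ OMTrivial Φ)
    (hΦ0 : ∃ a b : ℝ, Filter.Tendsto Φ (nhdsWithin 0 (Set.Ioi 0)) (nhds a) ∧
      Filter.Tendsto (transFun Φ) (nhdsWithin 0 (Set.Ioi 0)) (nhds b) ∧ 0 < a + b)
    (hf : OMone f) (hsub : Subpreserves Φ f)
    (hf0 : Filter.Tendsto f (nhdsWithin 0 (Set.Ioi 0)) (nhds 0)) :
    ∀ t : ℝ, 0 < t → f t = t := by
  obtain ⟨a, b, ha, hb, hab⟩ := hΦ0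
  obtain ⟨hΦpos, hΦ1, hΦm⟩ := hΦ
  obtain ⟨hfpos, hf1, hfm⟩ := hf
  have hΦc := hΦm.concaveOn
  have hfc := hfm.concaveOn
  have hsc := fun x y hx hy => hsub.scalar_le hfpos (x := x) (y := y) hx hy
  have haΦ : ∀ t, 0 < t → a ≤ Φ t := fun t ht =>
    le_of_tendsto_nhdsGT_of_monotone ha (fun _ _ => hΦm.monotone_s6) ht
  have hbΦ : ∀ t, 0 < t → b ≤ transFun Φ t := fun t ht =>
    le_of_tendsto_nhdsGT_of_monotone hb (fun _ _ => hΦc.transFun_le hΦpos) ht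
  have ha1 : a < 1 := by
    by_contra! h
    refine hΦnt (Or.inl fun t ht => ?_)
    have h1 := hΦc.add_transFun_le hΦ1 ht
    have h2 : t * 1 ≤ transFun Φ t :=
      mul_le_mul_of_nonneg_left (h.trans (haΦ _ (inv_pos.2 ht))) ht.le
    linarith [haΦ t ht]
  have hb1 : b < 1 := by
    by_contra! h
    refine hΦnt (Or.inr fun t ht => ?_)
    have h1 := hΦc.add_transFun_le hΦ1 ht
    have h2 := h.trans (hbΦ _ (inv_pos.2 ht))
    rw [transFun, inv_inv, inv_mul_eq_div, one_le_div ht] at h2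
    linarith [hbΦ t ht]
  intro t ht
  rcases lt_or_ge 0 a with h | h
  · exact hfc.eq_id_of_le_mul hfpos hf1 h ha1
      (fun x hx => le_mul_of_tendsto_of_subpreserving hfc hfpos hf0 h ha hsc hx) ht
  · have hb0 : 0 < b := by linarith
    refine hfc.eq_id_of_le_mul hfpos hf1 hb0 hb1
      (fun x hx => le_mul_of_tendsto_of_subpreserving hfc hfpos hf0 hb0 hb ?_ hx) ht
    have htr : ∀ {x y : ℝ}, 0 < x → x * transFun Φ (y / x) = y * Φ (x / y) := by
      intro x y hx
      rw [transFun, inv_div, ← mul_assoc, mul_div_cancel₀ _ hx.ne']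
    intro x y hx hy
    rw [htr hx, htr (hfpos x hx)]
    exact hsc y x hy hx
end
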